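/- For every integer n ≥ 3, the sequence s ↦ ‖P_s‖₂/P_s(1) is (weakly) decreasing in s; equivalently, for all s ≥ 0, ‖P_{s+1}‖₂/P_{s+1}(1) ≤ ‖P_s‖₂/P_s(1). -/

import Mathlib

open Polynomial Set

/-- `IsJacobi α s P` says that `P` is the Jacobi polynomial `P_s^{(α,α)}`:
the unique real polynomial of degree `s` orthogonal to all lower-degree
monomials with respect to the weight `(1 - t²)^α` on `(-1,1)`, normalized by
`P(1) = Γ(s+α+1)/(Γ(α+1)·s!)`. -/
def IsJacobi (α : ℝ) (s : ℕ) (P : Polynomial ℝ) : Prop :=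
  P.degree = (s : ℕ) ∧
  (∀ j < s, (∫ t in (-1 : ℝ)..1, P.eval t * t ^ j * (1 - t ^ 2) ^ α) = 0) ∧
  P.eval 1 = Real.Gamma ((s : ℝ) + α + 1) / (Real.Gamma (α + 1) * (Nat.factorial s : ℝ))

/-- The weight function `w(t) = (1-t²)^{(n-3)/2}`. -/
noncomputable def jWeight (n : ℕ) (t : ℝ) : ℝ := (1 - t ^ 2) ^ (((n : ℝ) - 3) / 2)

/-- `‖P‖₂ = (∫_{-1}^1 P(t)² (1-t²)^{(n-3)/2} dt)^{1/2}`. -/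
noncomputable def jNorm (n : ℕ) (P : Polynomial ℝ) : ℝ :=
  Real.sqrt (∫ t in (-1 : ℝ)..1, (P.eval t) ^ 2 * jWeight n t)

/-- The linear functional `p ↦ ∫ p(t) (1-t²)^α dt` over `(-1,1)` on real polynomials. -/
noncomputable def weightedIntegral (α : ℝ) (p : ℝ[X]) : ℝ :=
  ∫ t in (-1 : ℝ)..1, p.eval t * (1 - t ^ 2) ^ α

/-- The ultraspherical polynomials for the weight `(1-t²)^α`, normalized to be `1` at `1`. -/
noncomputable def ultraspherical (α : ℝ) : ℕ → ℝ[X]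
  | 0 => 1
  | 1 => X
  | s + 2 => C ((2 * s + 2 * α + 3) / (s + 2 * α + 2)) * (X * ultraspherical α (s + 1))
      - C ((s + 1) / (s + 2 * α + 2)) * ultraspherical α s

section WeightedIntegral

variable {α : ℝ}

lemma continuous_weighted (hα : 0 ≤ α) (p : ℝ[X]) :
    Continuous fun t : ℝ => p.eval t * (1 - t ^ 2) ^ α :=
  p.continuous.mul ((by fun_prop : Continuous fun t : ℝ => 1 - t ^ 2).rpow_const
    fun _ => Or.inr hα)

lemma weightedIntegral_add (hα : 0 ≤ α) (p q : ℝ[X]) :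
    weightedIntegral α (p + q) = weightedIntegral α p + weightedIntegral α q := by
  unfold weightedIntegral
  rw [← intervalIntegral.integral_add ((continuous_weighted hα p).intervalIntegrable _ _)
    ((continuous_weighted hα q).intervalIntegrable _ _)]
  simp only [eval_add, add_mul]

lemma weightedIntegral_C_mul (c : ℝ) (p : ℝ[X]) :
    weightedIntegral α (C c * p) = c * weightedIntegral α p := by
  unfold weightedIntegral
  rw [← intervalIntegral.integral_const_mul]
  simp only [eval_mul, eval_C, mul_assoc]

lemma weightedIntegral_sub (hα : 0 ≤ α) (p q : ℝ[X]) :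
    weightedIntegral α (p - q) = weightedIntegral α p - weightedIntegral α q := by
  have h : p - q = p + C (-1) * q := by simp [sub_eq_add_neg]
  rw [h, weightedIntegral_add hα, weightedIntegral_C_mul]
  ring

lemma one_sub_sq_nonneg {t : ℝ} (ht : t ∈ Icc (-1 : ℝ) 1) : 0 ≤ 1 - t ^ 2 := by
  nlinarith [ht.1, ht.2]

lemma weightedIntegral_sq_nonneg (p : ℝ[X]) : 0 ≤ weightedIntegral α (p ^ 2) := by
  refine intervalIntegral.integral_nonneg (by norm_num) fun t ht => ?_
  rw [eval_pow]
  exact mul_nonneg (sq_nonneg _) (Real.rpow_nonneg (one_sub_sq_nonneg ht) _)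

lemma eq_zero_of_weightedIntegral_sq_eq_zero (hα : 0 ≤ α) {p : ℝ[X]}
    (h : weightedIntegral α (p ^ 2) = 0) : p = 0 := by
  by_contra hp
  obtain ⟨c, hc, hpc⟩ : ∃ c ∈ Ioo (-1 : ℝ) 1, p.eval c ≠ 0 := by
    by_contra! hall
    refine hp (Polynomial.eq_zero_of_infinite_isRoot p ?_)
    exact (Ioo_infinite (by norm_num : (-1 : ℝ) < 1)).mono fun t ht => hall t ht
  refine (intervalIntegral.integral_pos (by norm_num : (-1 : ℝ) < 1)
    (continuous_weighted hα (p ^ 2)).continuousOn (fun t ht => ?_)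
    ⟨c, Ioo_subset_Icc_self hc, ?_⟩).ne' h
  · rw [eval_pow]
    exact mul_nonneg (sq_nonneg _)
      (Real.rpow_nonneg (one_sub_sq_nonneg (Ioc_subset_Icc_self ht)) _)
  · rw [eval_pow]
    exact mul_pos (by positivity) (Real.rpow_pos_of_pos (by nlinarith [hc.1, hc.2]) _)

/-- Integration by parts against the weight: the boundary terms vanish. -/
lemma weightedIntegral_derivative (hα : 0 ≤ α) (p : ℝ[X]) :
    weightedIntegral α ((1 - X ^ 2) * derivative p)
      = 2 * (α + 1) * weightedIntegral α (X * p) := by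
  rw [← weightedIntegral_C_mul, ← sub_eq_zero, ← weightedIntegral_sub hα]
  have hderiv : ∀ t ∈ uIcc (-1 : ℝ) 1,
      HasDerivAt (fun t : ℝ => p.eval t * (1 - t ^ 2) ^ (α + 1))
        (((1 - X ^ 2) * derivative p - C (2 * (α + 1)) * (X * p)).eval t
          * (1 - t ^ 2) ^ α) t := by
    intro t ht
    rw [uIcc_of_le (by norm_num)] at ht
    have hbase : HasDerivAt (fun t : ℝ => 1 - t ^ 2) (-(2 * t)) t := by
      simpa using (hasDerivAt_pow 2 t).const_sub 1
    refine ((p.hasDerivAt t).mul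
      (hbase.rpow_const (p := α + 1) (Or.inr (by linarith)))).congr_deriv ?_
    rw [Real.rpow_add_one' (one_sub_sq_nonneg ht) (by linarith), add_sub_cancel_right]
    simp only [eval_sub, eval_mul, eval_one, eval_pow, eval_X, eval_C]
    ring
  unfold weightedIntegral
  rw [intervalIntegral.integral_eq_sub_of_hasDerivAt hderiv
    ((continuous_weighted hα _).intervalIntegrable _ _)]
  simp [Real.zero_rpow (by linarith : α + 1 ≠ 0)]

lemma weightedIntegral_mul_eq_zero (hα : 0 ≤ α) {q : ℝ[X]} {s : ℕ}
    (hq : ∀ j < s, weightedIntegral α (X ^ j * q) = 0) {p : ℝ[X]} (hp : p.degree < s) :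
    weightedIntegral α (p * q) = 0 := by
  have key : ∀ m ≤ s, weightedIntegral α ((∑ i ∈ Finset.range m, C (p.coeff i) * X ^ i) * q)
      = 0 := by
    intro m hm
    induction m with
    | zero => simp [weightedIntegral]
    | succ m ih =>
      rw [Finset.sum_range_succ, add_mul, weightedIntegral_add hα, ih (by omega), mul_assoc,
        weightedIntegral_C_mul, hq m hm]
      simp
  rcases eq_or_ne p 0 with rfl | hp0
  · simp [weightedIntegral]
  · rw [p.as_sum_range_C_mul_X_pow]
    exact key _ ((natDegree_lt_iff_degree_lt hp0).2 hp)

/-- Orthogonal polynomials of the same degree are proportional. -/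
lemma eq_C_mul_of_orthogonal (hα : 0 ≤ α) {P q : ℝ[X]} {s : ℕ}
    (hPdeg : P.degree = s) (hqdeg : q.degree = s)
    (hP : ∀ j < s, weightedIntegral α (X ^ j * P) = 0)
    (hq : ∀ j < s, weightedIntegral α (X ^ j * q) = 0) :
    ∃ c : ℝ, P = C c * q := by
  have hq0 : q ≠ 0 := by rintro rfl; simp at hqdeg
  have hP0 : P ≠ 0 := by rintro rfl; simp at hPdeg
  have hlq : q.leadingCoeff ≠ 0 := leadingCoeff_ne_zero.2 hq0
  have hlP : P.leadingCoeff ≠ 0 := leadingCoeff_ne_zero.2 hP0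
  refine ⟨P.leadingCoeff / q.leadingCoeff, sub_eq_zero.1 ?_⟩
  set c := P.leadingCoeff / q.leadingCoeff with hc
  have hc0 : c ≠ 0 := div_ne_zero hlP hlq
  have hdeg : (P - C c * q).degree < s := by
    rw [← hPdeg]
    refine degree_sub_lt_left ?_ hP0 ?_
    · rw [degree_C_mul hc0, hPdeg, hqdeg]
    · rw [leadingCoeff_mul, leadingCoeff_C, hc, div_mul_cancel₀ _ hlq]
  refine eq_zero_of_weightedIntegral_sq_eq_zero hα ?_
  rw [sq, show (P - C c * q) * (P - C c * q)
    = (P - C c * q) * P - C c * ((P - C c * q) * q) by ring, weightedIntegral_sub hα,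
    weightedIntegral_C_mul, weightedIntegral_mul_eq_zero hα hP hdeg,
    weightedIntegral_mul_eq_zero hα hq hdeg]
  simp

end WeightedIntegral

section Ultraspherical

variable {α : ℝ}

/-- The three-term recurrence, cleared of denominators. -/
lemma ultraspherical_recurrence (hα : 0 ≤ α) (s : ℕ) :
    C (s + 2 * α + 2) * ultraspherical α (s + 2)
      = C (2 * s + 2 * α + 3) * (X * ultraspherical α (s + 1))
        - C (s + 1 : ℝ) * ultraspherical α s := by
  have h : (s : ℝ) + 2 * α + 2 ≠ 0 := by positivity
  rw [ultraspherical, mul_sub, ← mul_assoc, ← mul_assoc _ (C _) (ultraspherical α s), ← C_mul,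
    ← C_mul, mul_div_cancel₀ _ h, mul_div_cancel₀ _ h]

lemma ultraspherical_eval_one (hα : 0 ≤ α) (s : ℕ) : (ultraspherical α s).eval 1 = 1 := by
  induction s using Nat.twoStepInduction with
  | zero => simp [ultraspherical]
  | one => simp [ultraspherical]
  | more s ih₀ ih₁ =>
    have h : (s : ℝ) + 2 * α + 2 ≠ 0 := by positivity
    simp only [ultraspherical, eval_sub, eval_mul, eval_C, eval_X, ih₀, ih₁]
    field_simp
    ring

lemma ultraspherical_degree (hα : 0 ≤ α) (s : ℕ) : (ultraspherical α s).degree = s := by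
  induction s using Nat.twoStepInduction with
  | zero => simp [ultraspherical]
  | one => simp [ultraspherical]
  | more s ih₀ ih₁ =>
    have h : (2 * s + 2 * α + 3) / (s + 2 * α + 2) ≠ 0 := by positivity
    have h' : ((s : ℝ) + 1) / (s + 2 * α + 2) ≠ 0 := by positivity
    have htop : (C ((2 * s + 2 * α + 3) / (s + 2 * α + 2))
        * (X * ultraspherical α (s + 1))).degree = ((s + 2 : ℕ) : WithBot ℕ) := by
      rw [degree_C_mul h, degree_mul, degree_X, ih₁]
      norm_cast
      omega
    rw [ultraspherical, degree_sub_eq_left_of_degree_lt, htop]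
    rw [htop, degree_C_mul h', ih₀]
    norm_cast
    omega

lemma ultraspherical_derivative (hα : 0 ≤ α) (s : ℕ) :
    (1 - X ^ 2) * derivative (ultraspherical α (s + 1))
        = C (s + 1 : ℝ) * (ultraspherical α s - X * ultraspherical α (s + 1)) ∧
      (1 - X ^ 2) * derivative (ultraspherical α s)
        = C (s + 2 * α + 1) * (X * ultraspherical α s - ultraspherical α (s + 1)) := by
  induction s with
  | zero =>
    simp [ultraspherical]
    ring
  | succ s ih =>
    obtain ⟨ih₁, ih₀⟩ := ih
    have hrec := ultraspherical_recurrence hα s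
    have hne : (C ((s : ℝ) + 2 * α + 2)) ≠ 0 := C_ne_zero.2 (by positivity)
    have hder := congrArg derivative hrec
    simp only [derivative_sub, derivative_mul, derivative_C, derivative_X, zero_mul, zero_add] at hder
    generalize ultraspherical α (s + 2) = r at *
    generalize ultraspherical α (s + 1) = q at *
    generalize ultraspherical α s = p at *
    push_cast
    simp only [C_add, C_mul, map_natCast, map_ofNat, map_one] at *
    refine ⟨mul_left_cancel₀ hne ?_, ?_⟩
    · linear_combination (1 - X ^ 2) * hder + (2 * (s : ℝ[X]) + 2 * C α + 3) * X * ih₁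
        - ((s : ℝ[X]) + 1) * ih₀ + ((s : ℝ[X]) + 2) * X * hrec
    · linear_combination ih₁ + hrec

lemma weightedIntegral_ultraspherical (hα : 0 ≤ α) (s : ℕ) :
    weightedIntegral α (ultraspherical α (s + 1)) = 0 := by
  have hE : ∀ s : ℕ, (s - 1) * weightedIntegral α (X * ultraspherical α s)
      = (s + 2 * α + 1) * weightedIntegral α (ultraspherical α (s + 1)) := by
    intro s
    have h := weightedIntegral_derivative hα (ultraspherical α s)
    rw [(ultraspherical_derivative hα s).2, weightedIntegral_C_mul,
      weightedIntegral_sub hα] at h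
    linarith
  have hD : ∀ s : ℕ, (s + 1) * weightedIntegral α (ultraspherical α s)
      = (s + 2 * α + 3) * weightedIntegral α (X * ultraspherical α (s + 1)) := by
    intro s
    have h := weightedIntegral_derivative hα (ultraspherical α (s + 1))
    rw [(ultraspherical_derivative hα s).1, weightedIntegral_C_mul,
      weightedIntegral_sub hα] at h
    linarith
  induction s using Nat.twoStepInduction with
  | zero =>
    have h := hE 0
    simp only [ultraspherical, mul_one, Nat.cast_zero] at h ⊢
    have : (2 * α + 2) * weightedIntegral α X = 0 := by linarith
    exact (mul_eq_zero.1 this).resolve_left (by positivity)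
  | one =>
    have h := hE 1
    have h' : ((1 : ℕ) + 2 * α + 1) * weightedIntegral α (ultraspherical α (1 + 1)) = 0 := by
      rw [← h]; simp
    exact (mul_eq_zero.1 h').resolve_left (by positivity)
  | more s ih₀ _ =>
    have h := hD (s + 1)
    rw [ih₀, mul_zero] at h
    have h₁ := (mul_eq_zero.1 h.symm).resolve_left (by positivity)
    have h₂ := hE (s + 2)
    rw [h₁, mul_zero] at h₂
    exact (mul_eq_zero.1 h₂.symm).resolve_left (by positivity)

lemma ultraspherical_orthogonal (hα : 0 ≤ α) (s j : ℕ) (hj : j < s) :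
    weightedIntegral α (X ^ j * ultraspherical α s) = 0 := by
  induction j generalizing s with
  | zero =>
    obtain ⟨s, rfl⟩ := Nat.exists_eq_succ_of_ne_zero hj.ne'
    simpa using weightedIntegral_ultraspherical hα s
  | succ j ih =>
    obtain ⟨s, rfl⟩ := Nat.exists_eq_add_of_le' (Nat.one_le_of_lt hj)
    have hrec := congrArg (fun p => weightedIntegral α (X ^ j * p))
      (ultraspherical_recurrence hα s)
    simp only [mul_sub, mul_left_comm (X ^ j) (C _), weightedIntegral_sub hα,
      weightedIntegral_C_mul, ih (s + 2) (by omega), ih s (by omega), mul_zero, sub_zero] at hrec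
    rw [pow_succ, mul_assoc]
    exact (mul_eq_zero.1 hrec.symm).resolve_left (by positivity)

lemma ultraspherical_mul_eq_zero (hα : 0 ≤ α) {r s : ℕ} (h : r < s) :
    weightedIntegral α (ultraspherical α r * ultraspherical α s) = 0 :=
  weightedIntegral_mul_eq_zero hα (ultraspherical_orthogonal hα s)
    (by rw [ultraspherical_degree hα]; exact_mod_cast h)

lemma weightedIntegral_ultraspherical_sq_succ (hα : 0 ≤ α) (s : ℕ) :
    (2 * s + 2 * α + 3) * (s + 2 * α + 1)
        * weightedIntegral α (ultraspherical α (s + 1) ^ 2)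
      = (2 * s + 2 * α + 1) * (s + 1) * weightedIntegral α (ultraspherical α s ^ 2) := by
  have hlow : (2 * s + 2 * α + 3)
        * weightedIntegral α (X * ultraspherical α (s + 1) * ultraspherical α s)
      = (s + 1) * weightedIntegral α (ultraspherical α s ^ 2) := by
    have hrec := congrArg (fun p => weightedIntegral α (ultraspherical α s * p))
      (ultraspherical_recurrence hα s)
    simp only [mul_sub, mul_left_comm (ultraspherical α s) (C _), weightedIntegral_sub hα,
      weightedIntegral_C_mul, ultraspherical_mul_eq_zero hα (show s < s + 2 by omega)] at hrec
    rw [sq, mul_comm _ (ultraspherical α s)]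
    linarith
  have hhigh : (2 * s + 2 * α + 1)
        * weightedIntegral α (X * ultraspherical α (s + 1) * ultraspherical α s)
      = (s + 2 * α + 1) * weightedIntegral α (ultraspherical α (s + 1) ^ 2) := by
    cases s with
    | zero => simp [ultraspherical, sq]
    | succ s =>
      have hrec := congrArg (fun p => weightedIntegral α (p * ultraspherical α (s + 2)))
        (ultraspherical_recurrence hα s)
      simp only [sub_mul, mul_assoc, weightedIntegral_sub hα,
        weightedIntegral_C_mul, ultraspherical_mul_eq_zero hα (show s < s + 2 by omega)] at hrec
      rw [sq, mul_assoc, mul_comm (ultraspherical α (s + 1 + 1))]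
      push_cast
      linarith
  linear_combination (2 * s + 2 * α + 1) * hlow - (2 * s + 2 * α + 3) * hhigh

lemma weightedIntegral_ultraspherical_sq_antitone (hα : 0 ≤ α) (s : ℕ) :
    weightedIntegral α (ultraspherical α (s + 1) ^ 2)
      ≤ weightedIntegral α (ultraspherical α s ^ 2) := by
  have h := weightedIntegral_ultraspherical_sq_succ hα s
  have hpos : 0 < (2 * s + 2 * α + 3) * (s + 2 * α + 1) := by positivity
  refine le_of_mul_le_mul_left (h.le.trans ?_) hpos
  refine mul_le_mul_of_nonneg_right ?_ (weightedIntegral_sq_nonneg _)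
  nlinarith [mul_nonneg (Nat.cast_nonneg (α := ℝ) s) hα]

end Ultraspherical

lemma IsJacobi.eval_one_pos {α : ℝ} (hα : 0 ≤ α) {s : ℕ} {P : ℝ[X]} (hP : IsJacobi α s P) :
    0 < P.eval 1 := by
  rw [hP.2.2]
  have := Real.Gamma_pos_of_pos (show 0 < (s : ℝ) + α + 1 by positivity)
  have := Real.Gamma_pos_of_pos (show 0 < α + 1 by positivity)
  positivity

lemma IsJacobi.eq_C_mul_ultraspherical {α : ℝ} (hα : 0 ≤ α) {s : ℕ} {P : ℝ[X]}
    (hP : IsJacobi α s P) : P = C (P.eval 1) * ultraspherical α s := by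
  obtain ⟨c, hc⟩ := eq_C_mul_of_orthogonal hα hP.1 (ultraspherical_degree hα s)
    (fun j hj => by
      rw [← hP.2.1 j hj, weightedIntegral]
      simp only [eval_mul, eval_pow, eval_X, mul_comm])
    (ultraspherical_orthogonal hα s)
  have h1 : P.eval 1 = c := by
    rw [hc, eval_mul, eval_C, ultraspherical_eval_one hα, mul_one]
  rw [h1, ← hc]

lemma IsJacobi.jNorm_div_eval_one {n : ℕ} (hn : 3 ≤ n) {s : ℕ} {P : ℝ[X]}
    (hP : IsJacobi (((n : ℝ) - 3) / 2) s P) :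
    jNorm n P / P.eval 1
      = √(weightedIntegral (((n : ℝ) - 3) / 2) (ultraspherical (((n : ℝ) - 3) / 2) s ^ 2)) := by
  have hα : 0 ≤ ((n : ℝ) - 3) / 2 := by
    have : (3 : ℝ) ≤ n := by exact_mod_cast hn
    linarith
  have hpos := hP.eval_one_pos hα
  have hnorm : jNorm n P = √(weightedIntegral (((n : ℝ) - 3) / 2) (P ^ 2)) := by
    simp only [jNorm, jWeight, weightedIntegral, eval_pow]
  have hsq : P ^ 2 = C (P.eval 1 ^ 2) * ultraspherical (((n : ℝ) - 3) / 2) s ^ 2 := by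
    conv_lhs => rw [hP.eq_C_mul_ultraspherical hα]
    rw [mul_pow, C_pow]
  rw [hnorm, hsq, weightedIntegral_C_mul, Real.sqrt_mul (sq_nonneg _), Real.sqrt_sq hpos.le,
    mul_div_cancel_left₀ _ hpos.ne']

/-- Remark 2.4: the ratio `‖P_s‖₂/P_s(1)` is weakly decreasing in `s`. -/
theorem ratio_antitone (n : ℕ) (hn : 3 ≤ n)
    (P : ℕ → Polynomial ℝ) (hP : ∀ s, IsJacobi (((n : ℝ) - 3) / 2) s (P s))
    (s : ℕ) :
    jNorm n (P (s + 1)) / (P (s + 1)).eval 1 ≤ jNorm n (P s) / (P s).eval 1 := by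
  have hα : 0 ≤ ((n : ℝ) - 3) / 2 := by
    have : (3 : ℝ) ≤ n := by exact_mod_cast hn
    linarith
  rw [(hP (s + 1)).jNorm_div_eval_one hn, (hP s).jNorm_div_eval_one hn]
  exact Real.sqrt_le_sqrt (weightedIntegral_ultraspherical_sq_antitone hα s)
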